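/- arXiv:1506.06099 — 4 statements merged into one kernel-verified Lean document; each statement's English description precedes it below -/
import Mathlib

section
/- As the diffusivity D tends to 0 from above: (a) if v > 0, 0 < x ≤ L, and v c₀ ≠ q₀, then |c₁(x)| → ∞ (the total-flux solution blows up for outflow velocity); (b) if v > 0 and 0 ≤ x < L, then c₂(x) → c₀ (the diffusive-flux solution remains bounded); (c) if v < 0 and 0 < x ≤ L, then c₁(x) → q₀/v (the total-flux solution remains bounded); (d) if v < 0, 0 < x ≤ L, and q₀ ≠ 0, then |c₂(x)| → ∞ (the diffusive-flux solution blows up for inflow velocity). -/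
open Filter

theorem exp_div_top {a : ℝ} (ha : 0 < a) :
    Tendsto (fun D : ℝ => Real.exp (a / D)) (nhdsWithin 0 (Set.Ioi 0)) atTop := by
  refine Real.tendsto_exp_atTop.comp ?_
  exact ((tendsto_inv_nhdsGT_zero (𝕜 := ℝ)).const_mul_atTop ha).congr (fun D => (div_eq_mul_inv a D).symm)

theorem exp_div_zero {a : ℝ} (ha : a < 0) :
    Tendsto (fun D : ℝ => Real.exp (a / D)) (nhdsWithin 0 (Set.Ioi 0)) (nhds 0) := by
  refine Real.tendsto_exp_atBot.comp ?_
  exact ((tendsto_inv_nhdsGT_zero (𝕜 := ℝ)).const_mul_atTop_of_neg ha).congr (fun D => (div_eq_mul_inv a D).symm)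

theorem abs_blowup {l : Filter ℝ} {g E : ℝ → ℝ} {A b : ℝ} (hb : b ≠ 0)
    (hg : Tendsto g l (nhds b)) (hE : Tendsto E l atTop) :
    Tendsto (fun D => |A + g D * E D|) l atTop := by
  have h1 : Tendsto (fun D => |g D| * |E D|) l atTop :=
    hg.abs.pos_mul_atTop (abs_pos.mpr hb) (tendsto_abs_atTop_atTop.comp hE)
  refine tendsto_atTop_mono (fun D => ?_) (tendsto_atTop_add_const_right l (-|A|) h1)
  have h := abs_sub_abs_le_abs_sub (g D * E D) (-A)
  rw [abs_neg, abs_mul, sub_neg_eq_add, add_comm (g D * E D)] at h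
  linarith

/-- As the diffusivity `D` tends to `0` from above:
(a) if `v > 0`, `0 < x ≤ L`, and `v c₀ ≠ q₀`, then `|c₁(x)| → ∞` (the total-flux solution
blows up for outflow velocity);
(b) if `v > 0` and `0 ≤ x < L`, then `c₂(x) → c₀` (the diffusive-flux solution remains
bounded);
(c) if `v < 0` and `0 < x ≤ L`, then `c₁(x) → q₀/v` (the total-flux solution remains
bounded);
(d) if `v < 0`, `0 < x ≤ L`, and `q₀ ≠ 0`, then `|c₂(x)| → ∞` (the diffusive-flux solution
blows up for inflow velocity). -/
theorem vanishing_diffusivity_blowup (v L c₀ q₀ x : ℝ) (hv : v ≠ 0) (hL : 0 < L) :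
    let c₁ : ℝ → ℝ → ℝ := fun D x =>
      (1 / v) * (q₀ + (v * c₀ - q₀) * Real.exp (v * x / D))
    let c₂ : ℝ → ℝ → ℝ := fun D x =>
      (1 / v) * (v * c₀ + q₀ * Real.exp (-v * L / D) - q₀ * Real.exp (v * (x - L) / D))
    (0 < v → 0 < x → x ≤ L → v * c₀ ≠ q₀ →
      Tendsto (fun D => |c₁ D x|) (nhdsWithin 0 (Set.Ioi 0)) atTop) ∧
    (0 < v → 0 ≤ x → x < L →
      Tendsto (fun D => c₂ D x) (nhdsWithin 0 (Set.Ioi 0)) (nhds c₀)) ∧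
    (v < 0 → 0 < x → x ≤ L →
      Tendsto (fun D => c₁ D x) (nhdsWithin 0 (Set.Ioi 0)) (nhds (q₀ / v))) ∧
    (v < 0 → 0 < x → x ≤ L → q₀ ≠ 0 →
      Tendsto (fun D => |c₂ D x|) (nhdsWithin 0 (Set.Ioi 0)) atTop) := by
  intro c₁ c₂
  refine ⟨fun hv0 hx _ hne => ?_, fun hv0 _ hx => ?_, fun hv0 hx _ => ?_, fun hv0 hx _ hq => ?_⟩
  · have h := abs_blowup (A := (1 / v) * q₀) (b := (1 / v) * (v * c₀ - q₀))
      (mul_ne_zero (one_div_ne_zero hv) (sub_ne_zero.mpr hne)) tendsto_const_nhds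
      (exp_div_top (mul_pos hv0 hx))
    refine h.congr (fun D => ?_)
    simp only [c₁]
    congr 1
    ring
  · have h1 := exp_div_zero (a := -v * L) (by nlinarith)
    have h2 := exp_div_zero (a := v * (x - L)) (by nlinarith)
    have h := (((h1.const_mul q₀).const_add (v * c₀)).sub (h2.const_mul q₀)).const_mul (1 / v)
    have e : 1 / v * (v * c₀ + q₀ * 0 - q₀ * 0) = c₀ := by field_simp; ring
    rw [e] at h
    exact h
  · have h1 := exp_div_zero (a := v * x) (by nlinarith)
    have h := ((h1.const_mul (v * c₀ - q₀)).const_add q₀).const_mul (1 / v)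
    have e : 1 / v * (q₀ + (v * c₀ - q₀) * 0) = q₀ / v := by ring
    rw [e] at h
    exact h
  · have h1 := exp_div_zero (a := v * x) (by nlinarith)
    have h2 := exp_div_top (a := -v * L) (by nlinarith)
    have h3 := (h1.const_sub 1).const_mul (q₀ / v)
    have h := abs_blowup (A := c₀) (by simpa using ⟨hq, hv⟩) h3 h2
    refine h.congr (fun D => ?_)
    simp only [c₂]
    have e : Real.exp (v * (x - L) / D) = Real.exp (v * x / D) * Real.exp (-v * L / D) := by
      rw [← Real.exp_add]; congr 1; ring
    rw [e]
    congr 1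
    field_simp
    ring
end

section
/- Let α ≥ 0, D > 0, v ∈ ℝ, and h > 0, with not both α = 0 and v = 0. Then the two off-diagonal stiffness entries of the interior-node row are non-positive, i.e., αh/6 − v/2 − D/h ≤ 0 and αh/6 + v/2 − D/h ≤ 0 hold simultaneously, if and only if h ≤ 12D / (3|v| + √(9v² + 24αD)). -/
/-- Let `α ≥ 0`, `D > 0`, `v ∈ ℝ`, and `h > 0`, with not both `α = 0` and
`v = 0`. Then the two off-diagonal stiffness entries of the interior-node row are
non-positive, i.e., `αh/6 − v/2 − D/h ≤ 0` and `αh/6 + v/2 − D/h ≤ 0` hold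
simultaneously, if and only if `h ≤ 12D / (3|v| + √(9v² + 24αD))`. -/
theorem Z_matrix_condition_1D_ADR (α D v h : ℝ)
    (hα : 0 ≤ α) (hD : 0 < D) (hh : 0 < h) (hnz : ¬(α = 0 ∧ v = 0)) :
    (α * h / 6 - v / 2 - D / h ≤ 0 ∧ α * h / 6 + v / 2 - D / h ≤ 0) ↔
      h ≤ 12 * D / (3 * |v| + Real.sqrt (9 * v ^ 2 + 24 * α * D)) := by
  have hw : 0 ≤ |v| := abs_nonneg v
  have hrad : 0 < 9 * v ^ 2 + 24 * α * D := by
    by_cases hv : v = 0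
    · have ha : 0 < α := lt_of_le_of_ne hα (fun h0 => hnz ⟨h0.symm, hv⟩)
      positivity
    · positivity
  have hs : 0 < Real.sqrt (9 * v ^ 2 + 24 * α * D) := Real.sqrt_pos.mpr hrad
  have hsq : Real.sqrt (9 * v ^ 2 + 24 * α * D) ^ 2 = 9 * |v| ^ 2 + 24 * α * D := by
    rw [Real.sq_sqrt hrad.le, sq_abs]
  set s := Real.sqrt (9 * v ^ 2 + 24 * α * D) with hsdef
  have key : (α * h / 6 - v / 2 - D / h ≤ 0 ∧ α * h / 6 + v / 2 - D / h ≤ 0) ↔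
      α * h ^ 2 + 3 * |v| * h ≤ 6 * D := by
    have h1 : (α * h / 6 - v / 2 - D / h ≤ 0 ∧ α * h / 6 + v / 2 - D / h ≤ 0) ↔
        |v| ≤ 2 * (D / h) - α * h / 3 := by
      rw [abs_le]
      constructor
      · rintro ⟨a, b⟩
        constructor <;> linarith
      · rintro ⟨a, b⟩
        constructor <;> linarith
    have h2 : 2 * (D / h) - α * h / 3 = (6 * D - α * h ^ 2) / 3 / h := by
      field_simp
      try ring
    rw [h1, h2, le_div_iff₀ hh]
    constructor <;> intro a <;> linarith
  rw [key, le_div_iff₀ (by positivity)]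
  have hid : (12 * D - 3 * |v| * h) ^ 2 - (h * s) ^ 2
      = 24 * D * (6 * D - (α * h ^ 2 + 3 * |v| * h)) := by
    rw [mul_pow, hsq]
    ring
  have hah : 0 ≤ α * h ^ 2 := by positivity
  have hhs : 0 ≤ h * s := by positivity
  constructor
  · intro a
    have hp : 0 ≤ 12 * D - 3 * |v| * h := by linarith
    have hle : h * s ≤ 12 * D - 3 * |v| * h := by
      refine (sq_le_sq₀ hhs hp).mp ?_
      have : 0 ≤ 24 * D * (6 * D - (α * h ^ 2 + 3 * |v| * h)) :=
        mul_nonneg (by positivity) (by linarith)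
      linarith
    linarith
  · intro a
    have hle : h * s ≤ 12 * D - 3 * |v| * h := by linarith
    have h3 := pow_le_pow_left₀ hhs hle 2
    have h4 : 0 ≤ 24 * D * (6 * D - (α * h ^ 2 + 3 * |v| * h)) := by linarith
    have h5 := nonneg_of_mul_nonneg_right h4 (by positivity)
    linarith
end

section
/- For every w ∈ C¹(Ω̄) vanishing on ∂Ω and every p ∈ C¹(Ω̄; ℝ^d), the homogeneous weighted primitive least-squares functional satisfies the coercivity estimate F_Prim(w, p) ≥ (γ_min² λ_min² / (2(1 + C_pf²))) ‖∇w‖²_{L²(Ω)}. In particular there exists a constant C_Prim1 > 0 depending only on C_pf (independent of D and of any mesh size) such that F_Prim(w, p) ≥ C_Prim1 γ_min² λ_min² ‖∇w‖²_{L²(Ω)}. -/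
open MeasureTheory Matrix Set

/-- Gradient of a scalar field on `ℝ^d` (as `Fin d → ℝ`). -/
noncomputable def sgrad {d : ℕ} (f : (Fin d → ℝ) → ℝ) (x : Fin d → ℝ) : Fin d → ℝ :=
  fun i => fderiv ℝ f x (Pi.single i 1)

/-- Divergence of a vector field on `ℝ^d` (as `Fin d → ℝ`). -/
noncomputable def sdiv {d : ℕ} (F : (Fin d → ℝ) → (Fin d → ℝ)) (x : Fin d → ℝ) : ℝ :=
  ∑ i, fderiv ℝ (fun y => F y i) x (Pi.single i 1)

/-- The homogeneous (f = 0, full Dirichlet boundary) weighted primitive least-squares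
functional
`F_Prim(w, p) = (1/2)∫_Ω |A(x)(p − w v + D ∇w)|² dx + (1/2)∫_Ω β(x)²(α w + div p)² dx`. -/
noncomputable def FPrim {d : ℕ} (Ω : Set (Fin d → ℝ))
    (A Dm : (Fin d → ℝ) → Matrix (Fin d) (Fin d) ℝ)
    (β α : (Fin d → ℝ) → ℝ) (v : (Fin d → ℝ) → (Fin d → ℝ))
    (w : (Fin d → ℝ) → ℝ) (p : (Fin d → ℝ) → (Fin d → ℝ)) : ℝ :=
  (1 / 2) * (∫ x in Ω,
    ((A x).mulVec (fun i => p x i - w x * v x i + (Dm x).mulVec (sgrad w x) i)) ⬝ᵥ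
      ((A x).mulVec (fun i => p x i - w x * v x i + (Dm x).mulVec (sgrad w x) i))) +
  (1 / 2) * (∫ x in Ω, (β x) ^ 2 * (α x * w x + sdiv p x) ^ 2)


lemma aux_fderiv_bound {d : ℕ} {Ω : Set (Fin d → ℝ)} (hΩo : IsOpen Ω)
    (hΩb : Bornology.IsBounded Ω) {f : (Fin d → ℝ) → ℝ}
    (hf : ContDiffOn ℝ 1 f (closure Ω)) : ∃ C : ℝ, ∀ x ∈ Ω, ‖fderiv ℝ f x‖ ≤ C := by
  have hK : IsCompact (closure Ω) := hΩb.isCompact_closure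
  have key : ∃ C : ℝ, ∀ x ∈ closure Ω, x ∈ Ω → ‖fderiv ℝ f x‖ ≤ C := by
    refine hK.induction_on (p := fun s => ∃ C : ℝ, ∀ x ∈ s, x ∈ Ω → ‖fderiv ℝ f x‖ ≤ C)
      ⟨0, by simp⟩ ?_ ?_ ?_
    · rintro s t hst ⟨C, hC⟩
      exact ⟨C, fun x hx hx' => hC x (hst hx) hx'⟩
    · rintro s t ⟨C, hC⟩ ⟨C', hC'⟩
      refine ⟨max C C', ?_⟩
      rintro x (hx | hx) hx'
      · exact (hC x hx hx').trans (le_max_left _ _)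
      · exact (hC' x hx hx').trans (le_max_right _ _)
    · intro x hx
      have h1 := hf x hx
      rw [← zero_add (1 : WithTop ℕ∞), contDiffWithinAt_succ_iff_hasFDerivWithinAt (by simp)] at h1
      obtain ⟨u, hu, -, f', hf', hc⟩ := h1
      rw [insert_eq_of_mem hx] at hu
      have hcont := hc.continuousWithinAt.norm
      have hev : ∀ᶠ y in nhdsWithin x u, ‖f' y‖ < ‖f' x‖ + 1 :=
        hcont.eventually (gt_mem_nhds (by linarith))
      have hle : nhdsWithin x (closure Ω) ≤ nhdsWithin x u :=
        nhdsWithin_le_iff.2 hu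
      have hev2 := hle hev
      obtain ⟨O, hO, hxO, hOu⟩ := mem_nhdsWithin.1 hu
      refine ⟨{y | ‖f' y‖ < ‖f' x‖ + 1} ∩ O, Filter.inter_mem hev2
        (mem_nhdsWithin_of_mem_nhds (hO.mem_nhds hxO)), ‖f' x‖ + 1, ?_⟩
      rintro y ⟨hy1, hyO⟩ hyΩ
      have hyu : u ∈ nhds y := by
        filter_upwards [hO.mem_nhds hyO, hΩo.mem_nhds hyΩ] with z hz1 hz2
        exact hOu ⟨hz1, subset_closure hz2⟩
      have := (hf' y (mem_of_mem_nhds hyu)).hasFDerivAt hyu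
      rw [this.fderiv]
      exact le_of_lt hy1
  obtain ⟨C, hC⟩ := key
  exact ⟨C, fun x hx => hC x (subset_closure hx) hx⟩

lemma aux_diffAt {d : ℕ} {Ω : Set (Fin d → ℝ)} (hΩo : IsOpen Ω)
    {f : (Fin d → ℝ) → ℝ}
    (hf : ContDiffOn ℝ 1 f (closure Ω)) {x : Fin d → ℝ} (hx : x ∈ Ω) :
    DifferentiableAt ℝ f x :=
  (hf.mono subset_closure).differentiableOn (by simp) |>.differentiableAt (hΩo.mem_nhds hx)

lemma aux_segment {d : ℕ} {Ω : Set (Fin d → ℝ)} (hΩo : IsOpen Ω)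
    {f : (Fin d → ℝ) → ℝ}
    (hf : ContDiffOn ℝ 1 f (closure Ω)) {C : ℝ} (hC : ∀ x ∈ Ω, ‖fderiv ℝ f x‖ ≤ C)
    (x h : Fin d → ℝ) {T : ℝ} (hT : 0 ≤ T)
    (h1 : ∀ t ∈ Ico 0 T, x + t • h ∈ Ω) (h2 : ∀ t ∈ Icc 0 T, x + t • h ∈ closure Ω) :
    ‖f (x + T • h) - f x‖ ≤ C * ‖h‖ * T := by
  have hl : ∀ t : ℝ, HasDerivAt (fun t : ℝ => x + t • h) h t := by
    intro t
    simpa using ((hasDerivAt_id t).smul_const h).const_add x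
  have := norm_image_sub_le_of_norm_deriv_right_le_segment (a := 0) (b := T)
    (f := fun t : ℝ => f (x + t • h)) (f' := fun t => fderiv ℝ f (x + t • h) h) (C := C * ‖h‖)
    (hf.continuousOn.comp (by fun_prop) h2)
    (fun t ht => ((aux_diffAt hΩo hf (h1 t ht)).hasFDerivAt.comp_hasDerivAt t
      (hl t)).hasDerivWithinAt)
    (fun t ht => (ContinuousLinearMap.le_opNorm _ _).trans
      (mul_le_mul_of_nonneg_right (hC _ (h1 t ht)) (norm_nonneg _)))
    T ⟨hT, le_refl _⟩
  simpa using this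

lemma aux_out {d : ℕ} {Ω : Set (Fin d → ℝ)} (hΩo : IsOpen Ω)
    {f : (Fin d → ℝ) → ℝ}
    (hf : ContDiffOn ℝ 1 f (closure Ω)) (hf0 : ∀ y ∈ frontier Ω, f y = 0)
    {C : ℝ} (hC0 : 0 ≤ C) (hC : ∀ x ∈ Ω, ‖fderiv ℝ f x‖ ≤ C)
    {x y : Fin d → ℝ} (hx : x ∈ Ω) (hy : y ∉ Ω) : ‖f x‖ ≤ C * ‖y - x‖ := by
  have hcl : Continuous (fun t : ℝ => x + t • (y - x)) := by fun_prop
  have hS : IsCompact (Icc (0 : ℝ) 1 ∩ (fun t : ℝ => x + t • (y - x)) ⁻¹' Ωᶜ) :=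
    isCompact_Icc.inter_right (hΩo.isClosed_compl.preimage hcl)
  obtain ⟨T, ⟨hT01, hTΩ⟩, hTl⟩ := hS.exists_isLeast ⟨1, by simp, by simpa using hy⟩
  have h1 : ∀ t ∈ Ico 0 T, x + t • (y - x) ∈ Ω := by
    intro t ht
    by_contra hcon
    have := hTl ⟨⟨ht.1, ht.2.le.trans hT01.2⟩, hcon⟩
    exact absurd this (not_le.2 ht.2)
  have hTpos : 0 < T := by
    rcases hT01.1.eq_or_lt with h | h
    · exfalso
      apply hTΩ
      rw [← h]
      simpa using hx
    · exact h
  have hTc : x + T • (y - x) ∈ closure Ω := by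
    have hm : T ∈ closure (Ico 0 T) := by
      rw [closure_Ico hTpos.ne]; exact ⟨hT01.1, le_refl _⟩
    exact map_mem_closure (f := fun t : ℝ => x + t • (y - x)) hcl hm h1
  have h2 : ∀ t ∈ Icc 0 T, x + t • (y - x) ∈ closure Ω := by
    intro t ht
    rcases ht.2.eq_or_lt with h | h
    · rw [h]; exact hTc
    · exact subset_closure (h1 t ⟨ht.1, h⟩)
  have h3 := aux_segment hΩo hf hC x (y - x) hT01.1 h1 h2
  rw [hf0 _ ⟨hTc, by rw [hΩo.interior_eq]; exact hTΩ⟩, zero_sub, norm_neg] at h3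
  refine h3.trans ?_
  have : 0 ≤ C * ‖y - x‖ := by positivity
  nlinarith [hT01.2]

lemma aux_lip {d : ℕ} {Ω : Set (Fin d → ℝ)} (hΩo : IsOpen Ω)
    (hΩb : Bornology.IsBounded Ω) {f : (Fin d → ℝ) → ℝ}
    (hf : ContDiffOn ℝ 1 f (closure Ω)) (hf0 : ∀ y ∈ frontier Ω, f y = 0) :
    ∃ K : NNReal, LipschitzWith K (Ω.indicator f) := by
  obtain ⟨C', hC'⟩ := aux_fderiv_bound hΩo hΩb hf
  obtain ⟨C, hC0, hC⟩ : ∃ C : ℝ, 0 ≤ C ∧ ∀ x ∈ Ω, ‖fderiv ℝ f x‖ ≤ C :=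
    ⟨max C' 0, le_max_right _ _, fun x hx => (hC' x hx).trans (le_max_left _ _)⟩
  refine ⟨⟨C, hC0⟩, LipschitzWith.of_dist_le_mul fun x y => ?_⟩
  rw [dist_eq_norm, dist_eq_norm]
  change _ ≤ C * _
  by_cases hx : x ∈ Ω <;> by_cases hy : y ∈ Ω
  · rw [indicator_of_mem hx, indicator_of_mem hy]
    by_cases hseg : ∀ t ∈ Icc (0 : ℝ) 1, x + t • (y - x) ∈ Ω
    · have := aux_segment hΩo hf hC x (y - x) zero_le_one
        (fun t ht => hseg t ⟨ht.1, ht.2.le⟩) (fun t ht => subset_closure (hseg t ht))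
      rw [norm_sub_rev, norm_sub_rev x y]
      simpa using this
    · push Not at hseg
      obtain ⟨t, ht, htΩ⟩ := hseg
      have e1 := aux_out hΩo hf hf0 hC0 hC hx htΩ
      have e2 := aux_out hΩo hf hf0 hC0 hC hy htΩ
      have e3 : x + t • (y - x) - x = t • (y - x) := by module
      have e4 : x + t • (y - x) - y = (1 - t) • (x - y) := by module
      rw [e3, norm_smul, Real.norm_of_nonneg ht.1, norm_sub_rev y x] at e1
      have e5 : (0 : ℝ) ≤ 1 - t := by linarith [ht.2]
      rw [e4, norm_smul, Real.norm_of_nonneg e5] at e2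
      have := norm_sub_le (f x) (f y)
      nlinarith
  · rw [indicator_of_mem hx, indicator_of_notMem hy, sub_zero, norm_sub_rev x y]
    exact aux_out hΩo hf hf0 hC0 hC hx hy
  · rw [indicator_of_notMem hx, indicator_of_mem hy, zero_sub, norm_neg]
    exact aux_out hΩo hf hf0 hC0 hC hy hx
  · rw [indicator_of_notMem hx, indicator_of_notMem hy, sub_zero, norm_zero]
    positivity

lemma aux_ae_zero {d : ℕ} {s : Set (Fin d → ℝ)} (hs : MeasurableSet s)
    {f : (Fin d → ℝ) → ℝ} {K : NNReal} (hf : LipschitzWith K f) (hf0 : ∀ x ∈ s, f x = 0)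
    (i : Fin d) :
    ∀ᵐ x, x ∈ s → fderiv ℝ f x = 0 := by
  set e : Fin d → ℝ := Pi.single i 1 with he
  have hs' : MeasurableSet (s ∩ {x | DifferentiableAt ℝ f x}) :=
    hs.inter (measurableSet_of_differentiableAt ℝ f)
  have happ : ApproximatesLinearOn (fun x => f x • e) (0 : (Fin d → ℝ) →L[ℝ] (Fin d → ℝ))
      (s ∩ {x | DifferentiableAt ℝ f x}) 0 := by
    intro x hx y hy
    simp [hf0 x hx.1, hf0 y hy.1]
  have h := happ.norm_fderiv_sub_le volume hs' (fun x => (fderiv ℝ f x).smulRight e)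
    (fun x hx => (hx.2.hasFDerivAt.smul_const e).hasFDerivWithinAt)
  rw [ae_restrict_iff' hs'] at h
  filter_upwards [h, hf.ae_differentiableAt (μ := volume)] with x hx hd hxs
  have h0 := hx ⟨hxs, hd⟩
  simp only [sub_zero, nonpos_iff_eq_zero, nnnorm_eq_zero] at h0
  ext z
  have := congrFun (congrArg (fun L : (Fin d → ℝ) →L[ℝ] (Fin d → ℝ) => L z) h0) i
  simpa [he] using this

lemma aux_ibp {d : ℕ} {Ω : Set (Fin d → ℝ)} (hΩo : IsOpen Ω)
    (hΩb : Bornology.IsBounded Ω) {f : (Fin d → ℝ) → ℝ}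
    (hf : ContDiffOn ℝ 1 f (closure Ω)) (hf0 : ∀ y ∈ frontier Ω, f y = 0) (i : Fin d) :
    ∫ x in Ω, fderiv ℝ f x (Pi.single i 1) = 0 := by
  obtain ⟨K, hK⟩ := aux_lip hΩo hΩb hf hf0
  have hcs : HasCompactSupport (Ω.indicator f) :=
    HasCompactSupport.intro hΩb.isCompact_closure
      (fun x hx => indicator_of_notMem (fun h => hx (subset_closure h)) _)
  have h1 := LipschitzWith.integral_lineDeriv_mul_eq (μ := volume)
    (LipschitzWith.const (1 : ℝ)) hK hcs (-(Pi.single i 1 : Fin d → ℝ))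
  simp only [neg_neg, mul_one] at h1
  have h2 : ∀ x : Fin d → ℝ, lineDeriv ℝ (fun _ : Fin d → ℝ => (1 : ℝ)) x
      (-(Pi.single i 1)) = 0 := fun x => by simp [lineDeriv]
  simp only [h2, zero_mul, integral_zero] at h1
  rw [← integral_indicator hΩo.measurableSet, h1]
  apply integral_congr_ae
  filter_upwards [aux_ae_zero hΩo.measurableSet.compl hK
    (fun x hx => indicator_of_notMem hx _) i, hK.ae_differentiableAt (μ := volume)] with x hx hd
  rw [hd.lineDeriv_eq_fderiv]
  by_cases hxΩ : x ∈ Ω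
  · rw [indicator_of_mem hxΩ]
    have : Ω.indicator f =ᶠ[nhds x] f := by
      filter_upwards [hΩo.mem_nhds hxΩ] with y hy
      exact indicator_of_mem hy _
    rw [this.fderiv_eq]
  · rw [indicator_of_notMem hxΩ, hx hxΩ]; rfl

/-- Continuous and bounded on `Ω`. -/
def BC {d : ℕ} (Ω : Set (Fin d → ℝ)) (f : (Fin d → ℝ) → ℝ) : Prop :=
  ContinuousOn f Ω ∧ ∃ C : ℝ, ∀ x ∈ Ω, |f x| ≤ C

namespace BC

variable {d : ℕ} {Ω : Set (Fin d → ℝ)} {f g : (Fin d → ℝ) → ℝ}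

lemma add (hf : BC Ω f) (hg : BC Ω g) : BC Ω (fun x => f x + g x) := by
  obtain ⟨hf, C, hC⟩ := hf
  obtain ⟨hg, C', hC'⟩ := hg
  exact ⟨hf.add hg, C + C', fun x hx => (abs_add_le _ _).trans (add_le_add (hC x hx) (hC' x hx))⟩

lemma mul (hf : BC Ω f) (hg : BC Ω g) : BC Ω (fun x => f x * g x) := by
  obtain ⟨hf, C, hC⟩ := hf
  obtain ⟨hg, C', hC'⟩ := hg
  refine ⟨hf.mul hg, C * C', fun x hx => ?_⟩
  rw [abs_mul]
  exact mul_le_mul (hC x hx) (hC' x hx) (abs_nonneg _) ((abs_nonneg _).trans (hC x hx))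

lemma const (c : ℝ) : BC Ω (fun _ => c) := ⟨continuousOn_const, |c|, fun _ _ => le_refl _⟩

lemma sub (hf : BC Ω f) (hg : BC Ω g) : BC Ω (fun x => f x - g x) := by
  have := hf.add ((const (-1)).mul hg)
  simpa [sub_eq_add_neg] using this

lemma sq (hf : BC Ω f) : BC Ω (fun x => f x ^ 2) := by
  simpa [pow_two] using hf.mul hf

lemma sum {ι : Type} (s : Finset ι) {F : ι → (Fin d → ℝ) → ℝ} (h : ∀ i, BC Ω (F i)) :
    BC Ω (fun x => ∑ i ∈ s, F i x) := by
  classical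
  induction s using Finset.induction_on with
  | empty => simpa using const 0
  | insert a s ha ih => simpa [Finset.sum_insert ha] using (h a).add ih

lemma of_closure (hΩb : Bornology.IsBounded Ω) (hf : ContinuousOn f (closure Ω)) : BC Ω f := by
  refine ⟨hf.mono subset_closure, ?_⟩
  obtain ⟨C, hC⟩ := hΩb.isCompact_closure.exists_bound_of_continuousOn hf
  exact ⟨C, fun x hx => hC x (subset_closure hx)⟩

lemma of_fderiv (hΩo : IsOpen Ω) (hΩb : Bornology.IsBounded Ω)
    (hf : ContDiffOn ℝ 1 f (closure Ω)) (e : Fin d → ℝ) : BC Ω (fun x => fderiv ℝ f x e) := by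
  obtain ⟨C, hC⟩ := aux_fderiv_bound hΩo hΩb hf
  refine ⟨((hf.mono subset_closure).continuousOn_fderiv_of_isOpen hΩo (le_refl _)).clm_apply
    continuousOn_const, C * ‖e‖, fun x hx => ?_⟩
  exact (ContinuousLinearMap.le_opNorm _ _).trans
      (mul_le_mul_of_nonneg_right (hC x hx) (norm_nonneg _))

lemma integrableOn (hΩo : IsOpen Ω) (hΩb : Bornology.IsBounded Ω) (hf : BC Ω f) :
    IntegrableOn f Ω := by
  obtain ⟨hf, C, hC⟩ := hf
  exact IntegrableOn.of_bound hΩb.measure_lt_top (hf.aestronglyMeasurable hΩo.measurableSet) C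
    ((ae_restrict_iff' hΩo.measurableSet).2 (Filter.Eventually.of_forall hC))

end BC

lemma aux_weight {d : ℕ} (A : Matrix (Fin d) (Fin d) ℝ) {γ : ℝ} (hγ : 0 < γ)
    (y : Fin d → ℝ) (h : γ * (y ⬝ᵥ y) ≤ y ⬝ᵥ A.mulVec y) :
    γ ^ 2 * (y ⬝ᵥ y) ≤ A.mulVec y ⬝ᵥ A.mulVec y := by
  have h0 : 0 ≤ (A.mulVec y - γ • y) ⬝ᵥ (A.mulVec y - γ • y) := by
    simp only [dotProduct]
    exact Finset.sum_nonneg fun i _ => mul_self_nonneg _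
  simp only [sub_dotProduct, dotProduct_sub, smul_dotProduct, dotProduct_smul, smul_eq_mul,
    dotProduct_comm (A.mulVec y) y] at h0
  nlinarith

lemma aux_young {d : ℕ} (q g : Fin d → ℝ) {t : ℝ} (ht : 0 < t) :
    q ⬝ᵥ g ≤ 1 / (2 * t) * (q ⬝ᵥ q) + t / 2 * (g ⬝ᵥ g) := by
  simp only [dotProduct, Finset.mul_sum, ← Finset.sum_add_distrib]
  refine Finset.sum_le_sum fun i _ => ?_
  have : 1 / (2 * t) * (q i * q i) + t / 2 * (g i * g i) - q i * g i
    = 1 / (2 * t) * (q i - t * g i) ^ 2 := by field_simp; ring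
  have h2 : 0 ≤ 1 / (2 * t) * (q i - t * g i) ^ 2 := by positivity
  linarith

lemma aux_int {d : ℕ} {Ω : Set (Fin d → ℝ)} {a b g u j : (Fin d → ℝ) → ℝ} {c e : ℝ}
    (ha : IntegrableOn a Ω) (hb : IntegrableOn b Ω) (hg : IntegrableOn g Ω)
    (hu : IntegrableOn u Ω) (hj : IntegrableOn j Ω) :
    ∫ x in Ω, ((c * (a x + b x) + e * (g x + u x)) - j x) =
      c * ((∫ x in Ω, a x) + ∫ x in Ω, b x) + e * ((∫ x in Ω, g x) + ∫ x in Ω, u x)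
        - ∫ x in Ω, j x := by
  have h1 : IntegrableOn (fun x => c * (a x + b x)) Ω := (ha.add hb).const_mul c
  have h2 : IntegrableOn (fun x => e * (g x + u x)) Ω := (hg.add hu).const_mul e
  have h3 : IntegrableOn (fun x => c * (a x + b x) + e * (g x + u x)) Ω := h1.add h2
  rw [integral_sub h3 hj, integral_add h1 h2, integral_const_mul, integral_const_mul,
    integral_add ha hb, integral_add hg hu]

lemma aux_main {d : ℕ}
    (Ω : Set (Fin d → ℝ)) (hΩo : IsOpen Ω)
    (hΩb : Bornology.IsBounded Ω)
    (Dm : (Fin d → ℝ) → Matrix (Fin d) (Fin d) ℝ)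
    (hDcont : ∀ i j, ContinuousOn (fun x => Dm x i j) (closure Ω))
    (lmin : ℝ) (hlmin : 0 < lmin)
    (hell : ∀ x ∈ closure Ω, ∀ y : Fin d → ℝ,
      lmin * (y ⬝ᵥ y) ≤ y ⬝ᵥ (Dm x).mulVec y)
    (v : (Fin d → ℝ) → (Fin d → ℝ)) (α : (Fin d → ℝ) → ℝ)
    (hv : ContDiffOn ℝ 1 v (closure Ω)) (hα : ContDiffOn ℝ 1 α (closure Ω))
    (hsign2 : ∀ x ∈ Ω, 0 ≤ α x + (1 / 2) * sdiv v x)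
    (A : (Fin d → ℝ) → Matrix (Fin d) (Fin d) ℝ)
    (hAcont : ∀ i j, ContinuousOn (fun x => A x i j) (closure Ω))
    (β : (Fin d → ℝ) → ℝ) (hβcont : ContinuousOn β (closure Ω))
    (γmin : ℝ) (hγpos : 0 < γmin)
    (hγβ : ∀ x ∈ Ω, γmin ≤ β x)
    (hγA : ∀ x ∈ Ω, ∀ y : Fin d → ℝ, γmin * (y ⬝ᵥ y) ≤ y ⬝ᵥ (A x).mulVec y)
    (Cpf : ℝ)
    (w : (Fin d → ℝ) → ℝ) (p : (Fin d → ℝ) → (Fin d → ℝ))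
    (hpf : (∫ x in Ω, (w x) ^ 2) ≤ Cpf ^ 2 * ∫ x in Ω, sgrad w x ⬝ᵥ sgrad w x)
    (hw : ContDiffOn ℝ 1 w (closure Ω)) (hw0 : ∀ y ∈ frontier Ω, w y = 0)
    (hp : ContDiffOn ℝ 1 p (closure Ω)) :
    (γmin ^ 2 * lmin ^ 2 / (2 * (1 + Cpf ^ 2))) *
          (∫ x in Ω, sgrad w x ⬝ᵥ sgrad w x) ≤ FPrim Ω A Dm β α v w p := by
  have hpi : ∀ i, ContDiffOn ℝ 1 (fun x => p x i) (closure Ω) := contDiffOn_pi.1 hp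
  have hvi : ∀ i, ContDiffOn ℝ 1 (fun x => v x i) (closure Ω) := contDiffOn_pi.1 hv
  -- bounded continuous data
  have bw : BC Ω w := .of_closure hΩb hw.continuousOn
  have bα : BC Ω α := .of_closure hΩb hα.continuousOn
  have bβ : BC Ω β := .of_closure hΩb hβcont
  have bp : ∀ i, BC Ω (fun x => p x i) := fun i => .of_closure hΩb (hpi i).continuousOn
  have bv : ∀ i, BC Ω (fun x => v x i) := fun i => .of_closure hΩb (hvi i).continuousOn
  have bA : ∀ i j, BC Ω (fun x => A x i j) := fun i j => .of_closure hΩb (hAcont i j)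
  have bD : ∀ i j, BC Ω (fun x => Dm x i j) := fun i j => .of_closure hΩb (hDcont i j)
  have bg : ∀ i, BC Ω (fun x => sgrad w x i) := fun i => .of_fderiv hΩo hΩb hw _
  have bdp : BC Ω (sdiv p) := BC.sum Finset.univ fun i => .of_fderiv hΩo hΩb (hpi i) _
  have bdv : BC Ω (sdiv v) := BC.sum Finset.univ fun i => .of_fderiv hΩo hΩb (hvi i) _
  -- the flux residual
  set q : (Fin d → ℝ) → (Fin d → ℝ) := fun x i =>
    p x i - w x * v x i + (Dm x).mulVec (sgrad w x) i with hq
  have bq : ∀ i, BC Ω (fun x => q x i) := fun i =>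
    ((bp i).sub (bw.mul (bv i))).add (BC.sum Finset.univ fun j => (bD i j).mul (bg j))
  have bAq : ∀ i, BC Ω (fun x => (A x).mulVec (q x) i) := fun i =>
    BC.sum Finset.univ fun j => (bA i j).mul (bq j)
  have ba : BC Ω (fun x => (A x).mulVec (q x) ⬝ᵥ (A x).mulVec (q x)) :=
    BC.sum Finset.univ fun i => (bAq i).mul (bAq i)
  have bb : BC Ω (fun x => (β x) ^ 2 * (α x * w x + sdiv p x) ^ 2) :=
    bβ.sq.mul ((bα.mul bw).add bdp).sq
  have bG : BC Ω (fun x => sgrad w x ⬝ᵥ sgrad w x) :=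
    BC.sum Finset.univ fun i => (bg i).mul (bg i)
  have bgp : BC Ω (fun x => sgrad w x ⬝ᵥ p x) := BC.sum Finset.univ fun i => (bg i).mul (bp i)
  have bgv : BC Ω (fun x => sgrad w x ⬝ᵥ v x) := BC.sum Finset.univ fun i => (bg i).mul (bv i)
  -- integration by parts
  have hci : ∀ i, ContDiffOn ℝ 1 (fun x => w x * (p x i - 1 / 2 * (w x * v x i))) (closure Ω) :=
    fun i => hw.mul ((hpi i).sub (contDiffOn_const.mul (hw.mul (hvi i))))
  let J : (Fin d → ℝ) → ℝ := fun x =>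
    w x * sdiv p x + sgrad w x ⬝ᵥ p x - w x * (sgrad w x ⬝ᵥ v x)
      - 1 / 2 * (w x ^ 2 * sdiv v x)
  have bJ : BC Ω J :=
    (((bw.mul bdp).add bgp).sub (bw.mul bgv)).sub ((BC.const _).mul (bw.sq.mul bdv))
  have hJ : ∫ x in Ω, J x = 0 := by
    have h1 : ∫ x in Ω, ∑ i, fderiv ℝ (fun x => w x * (p x i - 1 / 2 * (w x * v x i))) x
        (Pi.single i 1) = 0 := by
      rw [integral_finsetSum _ fun i _ => (BC.of_fderiv hΩo hΩb (hci i) _).integrableOn hΩo hΩb]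
      exact Finset.sum_eq_zero fun i _ => aux_ibp hΩo hΩb (hci i)
        (fun y hy => by simp [hw0 y hy]) i
    rw [← h1]
    refine setIntegral_congr_fun hΩo.measurableSet fun x hx => ?_
    have dw := (aux_diffAt hΩo hw hx).hasFDerivAt
    have hder : ∀ i, fderiv ℝ (fun x => w x * (p x i - 1 / 2 * (w x * v x i))) x
        (Pi.single i 1) = w x * fderiv ℝ (fun y => p y i) x (Pi.single i 1)
          + sgrad w x i * p x i - w x * (sgrad w x i * v x i)
          - 1 / 2 * (w x ^ 2 * fderiv ℝ (fun y => v y i) x (Pi.single i 1)) := by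
      intro i
      have dp := (aux_diffAt hΩo (hpi i) hx).hasFDerivAt
      have dv := (aux_diffAt hΩo (hvi i) hx).hasFDerivAt
      have := dw.mul (dp.sub ((dw.mul dv).const_mul (1 / 2 : ℝ)))
      have h2 := this.fderiv
      have h3 : fderiv ℝ (fun x => w x * (p x i - 1 / 2 * (w x * v x i))) x = _ := h2
      rw [h3]
      simp [sgrad]
      ring
    simp only [hder, J, Finset.sum_sub_distrib, Finset.sum_add_distrib, ← Finset.mul_sum, _root_.sdiv,
      dotProduct]
  -- pointwise inequality
  set M : ℝ := 1 + Cpf ^ 2 with hM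
  have hMpos : 0 < M := by positivity
  have hpt : ∀ x ∈ Ω, lmin * (sgrad w x ⬝ᵥ sgrad w x) ≤
      (M / (2 * lmin * γmin ^ 2) * ((A x).mulVec (q x) ⬝ᵥ (A x).mulVec (q x)
        + (β x) ^ 2 * (α x * w x + sdiv p x) ^ 2)
        + lmin / (2 * M) * (sgrad w x ⬝ᵥ sgrad w x + w x ^ 2)) - J x := by
    intro x hx
    have e1 := hell x (subset_closure hx) (sgrad w x)
    have e2 := hsign2 x hx
    have e3 := aux_young (q x) (sgrad w x) (t := lmin / M) (by positivity)
    have e4 : (α x * w x + sdiv p x) * w x ≤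
        1 / (2 * (lmin / M)) * (α x * w x + sdiv p x) ^ 2 + lmin / M / 2 * w x ^ 2 := by
      have := aux_young (fun _ : Fin 1 => α x * w x + sdiv p x) (fun _ => w x)
        (t := lmin / M) (by positivity)
      simpa [dotProduct, pow_two] using this
    have e5 := aux_weight (A x) hγpos (q x) (hγA x hx _)
    have e6 : γmin ^ 2 * (α x * w x + sdiv p x) ^ 2 ≤
        β x ^ 2 * (α x * w x + sdiv p x) ^ 2 := by
      have := hγβ x hx
      gcongr
    have e7 : q x ⬝ᵥ sgrad w x = sgrad w x ⬝ᵥ p x - w x * (sgrad w x ⬝ᵥ v x)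
        + sgrad w x ⬝ᵥ (Dm x).mulVec (sgrad w x) := by
      simp only [hq, dotProduct, Finset.mul_sum, ← Finset.sum_add_distrib,
        ← Finset.sum_sub_distrib]
      exact Finset.sum_congr rfl fun i _ => by ring
    have e8 : 0 ≤ (α x + 1 / 2 * sdiv v x) * w x ^ 2 := by positivity
    have e9 : M / (2 * lmin * γmin ^ 2) * (γmin ^ 2 * (q x ⬝ᵥ q x)
        + γmin ^ 2 * (α x * w x + sdiv p x) ^ 2) ≤
        M / (2 * lmin * γmin ^ 2) * ((A x).mulVec (q x) ⬝ᵥ (A x).mulVec (q x)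
        + (β x) ^ 2 * (α x * w x + sdiv p x) ^ 2) := by
      gcongr
    have e10 : M / (2 * lmin * γmin ^ 2) * (γmin ^ 2 * (q x ⬝ᵥ q x)
        + γmin ^ 2 * (α x * w x + sdiv p x) ^ 2) =
        1 / (2 * (lmin / M)) * (q x ⬝ᵥ q x)
        + 1 / (2 * (lmin / M)) * (α x * w x + sdiv p x) ^ 2 := by
      field_simp
    have e11 : lmin / (2 * M) = lmin / M / 2 := by field_simp
    rw [e11]
    simp only [J]
    nlinarith
  -- integrate
  have ia := ba.integrableOn hΩo hΩb
  have ib := bb.integrableOn hΩo hΩb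
  have iG := bG.integrableOn hΩo hΩb
  have iw := bw.sq.integrableOn hΩo hΩb
  have iJ := bJ.integrableOn hΩo hΩb
  have hint := setIntegral_mono_on (iG.const_mul lmin)
    ((((ia.add ib).const_mul (M / (2 * lmin * γmin ^ 2))).add
      ((iG.add iw).const_mul (lmin / (2 * M)))).sub iJ) hΩo.measurableSet hpt
  have hR : ∫ x in Ω, ((M / (2 * lmin * γmin ^ 2) * ((A x).mulVec (q x) ⬝ᵥ (A x).mulVec (q x)
        + (β x) ^ 2 * (α x * w x + sdiv p x) ^ 2)
        + lmin / (2 * M) * (sgrad w x ⬝ᵥ sgrad w x + w x ^ 2)) - J x) =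
      M / (2 * lmin * γmin ^ 2) * ((∫ x in Ω, (A x).mulVec (q x) ⬝ᵥ (A x).mulVec (q x))
        + ∫ x in Ω, (β x) ^ 2 * (α x * w x + sdiv p x) ^ 2)
      + lmin / (2 * M) * ((∫ x in Ω, sgrad w x ⬝ᵥ sgrad w x) + ∫ x in Ω, w x ^ 2) := by
    rw [aux_int ia ib iG iw iJ, hJ, sub_zero]
  have hint2 : lmin * (∫ x in Ω, sgrad w x ⬝ᵥ sgrad w x) ≤
      M / (2 * lmin * γmin ^ 2) * ((∫ x in Ω, (A x).mulVec (q x) ⬝ᵥ (A x).mulVec (q x))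
        + ∫ x in Ω, (β x) ^ 2 * (α x * w x + sdiv p x) ^ 2)
      + lmin / (2 * M) * ((∫ x in Ω, sgrad w x ⬝ᵥ sgrad w x) + ∫ x in Ω, w x ^ 2) := by
    rw [← hR, ← integral_const_mul]
    exact hint
  have hF : FPrim Ω A Dm β α v w p =
      1 / 2 * (∫ x in Ω, (A x).mulVec (q x) ⬝ᵥ (A x).mulVec (q x))
        + 1 / 2 * ∫ x in Ω, (β x) ^ 2 * (α x * w x + sdiv p x) ^ 2 := rfl
  rw [hF]
  generalize (∫ x in Ω, (A x).mulVec (q x) ⬝ᵥ (A x).mulVec (q x)) = a at *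
  generalize (∫ x in Ω, (β x) ^ 2 * (α x * w x + sdiv p x) ^ 2) = b at *
  generalize (∫ x in Ω, sgrad w x ⬝ᵥ sgrad w x) = G at *
  generalize (∫ x in Ω, w x ^ 2) = W at *
  have h5 : lmin / (2 * M) * (G + W) ≤ lmin / 2 * G := by
    have : lmin / (2 * M) * (G + W) ≤ lmin / (2 * M) * (M * G) := by
      gcongr
      rw [hM]; linarith
    refine this.trans (le_of_eq ?_)
    field_simp
  have h6 : lmin / 2 * G ≤ M / (2 * lmin * γmin ^ 2) * (a + b) := by linarith
  have h7 : γmin ^ 2 * lmin / M * (lmin / 2 * G) ≤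
      γmin ^ 2 * lmin / M * (M / (2 * lmin * γmin ^ 2) * (a + b)) := by gcongr
  have h8 : γmin ^ 2 * lmin / M * (lmin / 2 * G) = γmin ^ 2 * lmin ^ 2 / (2 * M) * G := by
    field_simp
  have h9 : γmin ^ 2 * lmin / M * (M / (2 * lmin * γmin ^ 2) * (a + b)) =
      1 / 2 * a + 1 / 2 * b := by
    field_simp
  linarith

/-- For every `w ∈ C¹(Ω̄)` vanishing on `∂Ω` and every `p ∈ C¹(Ω̄; ℝ^d)`,
the homogeneous weighted primitive least-squares functional satisfies the coercivity
estimate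
`F_Prim(w, p) ≥ (γ_min² λ_min² / (2(1 + C_pf²))) ‖∇w‖²_{L²(Ω)}`.
In particular there exists a constant `C_Prim1 > 0` depending only on `C_pf`
(independent of `D` and of any mesh size) such that
`F_Prim(w, p) ≥ C_Prim1 γ_min² λ_min² ‖∇w‖²_{L²(Ω)}`. -/
theorem coercivity_weighted_primitive_LSFEM
    {d : ℕ} (hd : 1 ≤ d)
    (Ω : Set (Fin d → ℝ)) (hΩne : Ω.Nonempty) (hΩo : IsOpen Ω)
    (hΩb : Bornology.IsBounded Ω)
    -- diffusivity tensor: continuous, symmetric, with eigenvalue bounds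
    (Dm : (Fin d → ℝ) → Matrix (Fin d) (Fin d) ℝ)
    (hDcont : ∀ i j, ContinuousOn (fun x => Dm x i j) (closure Ω))
    (hDsymm : ∀ x ∈ closure Ω, (Dm x).IsSymm)
    (lmin lmax : ℝ) (hlmin : 0 < lmin) (hlord : lmin ≤ lmax)
    (hell : ∀ x ∈ closure Ω, ∀ y : Fin d → ℝ,
      lmin * (y ⬝ᵥ y) ≤ y ⬝ᵥ (Dm x).mulVec y ∧ y ⬝ᵥ (Dm x).mulVec y ≤ lmax * (y ⬝ᵥ y))
    -- advection velocity and reaction coefficient: C¹ with the sign restrictions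
    (v : (Fin d → ℝ) → (Fin d → ℝ)) (α : (Fin d → ℝ) → ℝ)
    (hv : ContDiffOn ℝ 1 v (closure Ω)) (hα : ContDiffOn ℝ 1 α (closure Ω))
    (hsign1 : ∀ x ∈ Ω, 0 ≤ α x + sdiv v x)
    (hsign2 : ∀ x ∈ Ω, 0 ≤ α x + (1 / 2) * sdiv v x)
    -- weights: A continuous symmetric positive definite, β continuous positive
    (A : (Fin d → ℝ) → Matrix (Fin d) (Fin d) ℝ)
    (hAcont : ∀ i j, ContinuousOn (fun x => A x i j) (closure Ω))
    (hApd : ∀ x ∈ closure Ω, (A x).PosDef)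
    (β : (Fin d → ℝ) → ℝ) (hβcont : ContinuousOn β (closure Ω))
    (hβpos : ∀ x ∈ closure Ω, 0 < β x)
    -- γ_min = min(1, inf β, inf (smallest eigenvalue of A)); encoded as: γ_min is
    -- positive, at most 1, and bounds β and the spectrum of A from below on Ω
    (γmin : ℝ) (hγpos : 0 < γmin) (hγ1 : γmin ≤ 1)
    (hγβ : ∀ x ∈ Ω, γmin ≤ β x)
    (hγA : ∀ x ∈ Ω, ∀ y : Fin d → ℝ, γmin * (y ⬝ᵥ y) ≤ y ⬝ᵥ (A x).mulVec y)
    -- the Poincaré–Friedrichs inequality with constant C_pf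
    (Cpf : ℝ) (hCpf : 0 < Cpf)
    (hpf : ∀ u : (Fin d → ℝ) → ℝ, ContDiffOn ℝ 1 u (closure Ω) →
      (∀ y ∈ frontier Ω, u y = 0) →
      (∫ x in Ω, (u x) ^ 2) ≤ Cpf ^ 2 * ∫ x in Ω, sgrad u x ⬝ᵥ sgrad u x) :
    (∀ (w : (Fin d → ℝ) → ℝ) (p : (Fin d → ℝ) → (Fin d → ℝ)),
      ContDiffOn ℝ 1 w (closure Ω) → (∀ y ∈ frontier Ω, w y = 0) →
      ContDiffOn ℝ 1 p (closure Ω) →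
      (γmin ^ 2 * lmin ^ 2 / (2 * (1 + Cpf ^ 2))) *
          (∫ x in Ω, sgrad w x ⬝ᵥ sgrad w x) ≤ FPrim Ω A Dm β α v w p) ∧
    (∃ CPrim1 > (0 : ℝ),
      ∀ (w : (Fin d → ℝ) → ℝ) (p : (Fin d → ℝ) → (Fin d → ℝ)),
        ContDiffOn ℝ 1 w (closure Ω) → (∀ y ∈ frontier Ω, w y = 0) →
        ContDiffOn ℝ 1 p (closure Ω) →
        CPrim1 * γmin ^ 2 * lmin ^ 2 * (∫ x in Ω, sgrad w x ⬝ᵥ sgrad w x) ≤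
          FPrim Ω A Dm β α v w p) := by
  have main := fun w p hw hw0 hp => aux_main Ω hΩo hΩb Dm hDcont lmin hlmin
    (fun x hx y => (hell x hx y).1) v α hv hα hsign2 A hAcont β hβcont γmin hγpos hγβ hγA
    Cpf w p (hpf w hw hw0) hw hw0 hp
  refine ⟨main, 1 / (2 * (1 + Cpf ^ 2)), by positivity, fun w p hw hw0 hp => ?_⟩
  refine le_trans (le_of_eq ?_) (main w p hw hw0 hp)
  ring
end

section
/- Suppose c_A ≥ 0, c_B ≥ 0, c_C ≥ 0 are real numbers satisfying the non-coexistence condition c_A c_B = 0 (the species A and B do not coexist), and define c_F = c_A + (n_A / n_C) c_C and c_G = c_B + (n_B / n_C) c_C. Then the concentrations are recovered from the invariants by c_A = max( c_F − (n_A / n_B) c_G , 0 ), c_B = max( c_G − (n_B / n_A) c_F , 0 ), and c_C = (n_C / n_A)( c_F − c_A ). -/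
/-- Suppose `c_A ≥ 0`, `c_B ≥ 0`, `c_C ≥ 0` are real numbers satisfying the
non-coexistence condition `c_A c_B = 0` (the species A and B do not coexist), and define
`c_F = c_A + (n_A / n_C) c_C` and `c_G = c_B + (n_B / n_C) c_C`. Then the concentrations
are recovered from the invariants by `c_A = max(c_F − (n_A/n_B) c_G, 0)`,
`c_B = max(c_G − (n_B/n_A) c_F, 0)`, and `c_C = (n_C/n_A)(c_F − c_A)`. -/
theorem bimolecular_invariants_recover_concentrations
    (nA nB nC cA cB cC : ℝ)
    (hnA : 0 < nA) (hnB : 0 < nB) (hnC : 0 < nC)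
    (hcA : 0 ≤ cA) (hcB : 0 ≤ cB) (hcC : 0 ≤ cC)
    (hnocoexist : cA * cB = 0)
    (cF cG : ℝ)
    (hcF : cF = cA + (nA / nC) * cC)
    (hcG : cG = cB + (nB / nC) * cC) :
    cA = max (cF - (nA / nB) * cG) 0 ∧
    cB = max (cG - (nB / nA) * cF) 0 ∧
    cC = (nC / nA) * (cF - cA) := by
  have h1 : cF - (nA / nB) * cG = cA - (nA / nB) * cB := by
    rw [hcF, hcG]; field_simp; ring
  have h2 : cG - (nB / nA) * cF = cB - (nB / nA) * cA := by
    rw [hcF, hcG]; field_simp; ring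
  have h3 : cC = (nC / nA) * (cF - cA) := by
    rw [hcF]; field_simp; ring
  refine ⟨?_, ?_, h3⟩
  · rw [h1]
    rcases mul_eq_zero.mp hnocoexist with h | h
    · have : 0 ≤ nA / nB * cB := by positivity
      rw [max_eq_right (by linarith), h]
    · rw [h, mul_zero, sub_zero, max_eq_left hcA]
  · rw [h2]
    rcases mul_eq_zero.mp hnocoexist with h | h
    · rw [h, mul_zero, sub_zero, max_eq_left hcB]
    · have : 0 ≤ nB / nA * cA := by positivity
      rw [max_eq_right (by linarith), h]
end
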